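/- Let ρ be a critical radius function on ℝ^n, θ ≥ 0, 0 < α < n, 1 ≤ p < ∞ and p ≤ q < ∞, and let μ, ν be weights. If M_α^{ρ,θ} is bounded from L^{p,1}(μ) to L^{q,∞}(ν), i.e. there is c > 0 with ‖M_α^{ρ,θ}f‖_{L^{q,∞}(ν)} ≤ c‖f‖_{L^{p,1}(μ)} for every measurable f, then 1/p − 1/q ≤ α/n. -/

import Mathlib

open MeasureTheory ENNReal Set
noncomputable section

/-- `ℝ^n` with the Euclidean norm. -/
abbrev Rn (n : ℕ) := EuclideanSpace ℝ (Fin n)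

/-- The cube of center `c` and side length `r`. -/
def cube {n : ℕ} (c : Rn n) (r : ℝ) : Set (Rn n) := {y | ∀ i, |y i - c i| ≤ r / 2}

/-- `ψ_θ(Q) = (1 + r_Q/ρ(x_Q))^θ` for the cube `Q` of center `c` and side length `r`. -/
def psi {n : ℕ} (ρ : Rn n → ℝ) (θ : ℝ) (c : Rn n) (r : ℝ) : ℝ := (1 + r / ρ c) ^ θ

/-- `ρ` is a critical radius function with constants `C₀, N₀`. -/
def IsCriticalRadiusWith {n : ℕ} (ρ : Rn n → ℝ) (C₀ N₀ : ℝ) : Prop :=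
  0 < C₀ ∧ 0 < N₀ ∧ (∀ x, 0 < ρ x) ∧ ∀ x y : Rn n,
    C₀⁻¹ * ρ x * (1 + ‖x - y‖ / ρ x) ^ (-N₀) ≤ ρ y ∧
    ρ y ≤ C₀ * ρ x * (1 + ‖x - y‖ / ρ x) ^ (N₀ / (N₀ + 1))

/-- `ρ` is a critical radius function. -/
def IsCriticalRadius {n : ℕ} (ρ : Rn n → ℝ) : Prop := ∃ C₀ N₀, IsCriticalRadiusWith ρ C₀ N₀

/-- A weight: locally integrable and a.e. positive. -/
def IsWeight {n : ℕ} (w : Rn n → ℝ) : Prop :=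
  LocallyIntegrable w (volume : Measure (Rn n)) ∧ ∀ᵐ x : Rn n, 0 < w x

/-- `w(S) = ∫_S w`. -/
def wMeas {n : ℕ} (w : Rn n → ℝ) (S : Set (Rn n)) : ℝ≥0∞ :=
  ∫⁻ x in S, ENNReal.ofReal (w x)

/-- Fractional maximal operator `M_α^{ρ,θ}` associated with the critical radius function `ρ`. -/
def fracMax (n : ℕ) (ρ : Rn n → ℝ) (θ α : ℝ) (f : Rn n → ℝ) (x : Rn n) : ℝ≥0∞ :=
  ⨆ (c : Rn n) (r : ℝ) (_ : 0 < r) (_ : x ∈ cube c r),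
    ENNReal.ofReal ((psi ρ θ c r * r ^ n) ^ (α / n - 1)) *
      ∫⁻ y in cube c r, ENNReal.ofReal |f y|

/-- The Lorentz `L^{p,1}(w)` norm. -/
def lorentzP1 {n : ℕ} (p : ℝ) (w : Rn n → ℝ) (f : Rn n → ℝ) : ℝ≥0∞ :=
  ENNReal.ofReal p * ∫⁻ y in Ioi (0 : ℝ), (wMeas w {x | y < |f x|}) ^ (1 / p)

/-- The weak `L^{q,∞}(w)` quasi-norm of an `ℝ≥0∞`-valued function. -/
def weakNormE {n : ℕ} (q : ℝ) (w : Rn n → ℝ) (F : Rn n → ℝ≥0∞) : ℝ≥0∞ :=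
  ⨆ (l : ℝ) (_ : 0 < l), ENNReal.ofReal l * (wMeas w {x | ENNReal.ofReal l < F x}) ^ (1 / q)

/-- The weak `L^{q,∞}(w)` quasi-norm of a real function, with `q = ∞` allowed
(in which case it is the `w`-essential supremum). -/
def weakNormR {n : ℕ} (q : ℝ≥0∞) (w : Rn n → ℝ) (f : Rn n → ℝ) : ℝ≥0∞ :=
  if q = ∞ then
    essSup (fun x => ENNReal.ofReal |f x|)
      ((volume : Measure (Rn n)).withDensity fun x => ENNReal.ofReal (w x))
  else ⨆ (l : ℝ) (_ : 0 < l), ENNReal.ofReal l * (wMeas w {x | l < |f x|}) ^ (1 / q.toReal)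

/-- The conjugate exponent `p' = p/(p-1)` (with `1' = ∞`), as an extended real number. -/
def conjE (p : ℝ) : ℝ≥0∞ := if p = 1 then ∞ else ENNReal.ofReal (p / (p - 1))

/-- The constant `[μ,ν]_{A_{p,q,α}^{ρ,θ,R}}`. -/
def ApqR {n : ℕ} (ρ : Rn n → ℝ) (θ α p q : ℝ) (μ ν : Rn n → ℝ) : ℝ≥0∞ :=
  ⨆ (c : Rn n) (r : ℝ) (_ : 0 < r),
    (wMeas ν (cube c r)) ^ (1 / q) *
      weakNormR (conjE p) μ ((cube c r).indicator fun x => (μ x)⁻¹) *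
      ENNReal.ofReal ((r ^ n * psi ρ θ c r) ^ (α / n - 1))

/-- The constant `‖μ,ν‖_{A_{p,q,α}^{ρ,θ,R}}`. -/
def normApqR {n : ℕ} (ρ : Rn n → ℝ) (θ α p q : ℝ) (μ ν : Rn n → ℝ) : ℝ≥0∞ :=
  ⨆ (c : Rn n) (r : ℝ) (_ : 0 < r),
    (wMeas ν (cube c r)) ^ (1 / q) *
      ⨆ (P : Set (Rn n)) (_ : MeasurableSet P) (_ : 0 < wMeas μ P) (_ : wMeas μ P ≠ ∞),
        volume (P ∩ cube c r) * ENNReal.ofReal ((r ^ n * psi ρ θ c r) ^ (α / n - 1)) *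
          (wMeas μ P) ^ (-(1 / p))

/-- The constant `[w]_{A_p^{ρ,σ}}` (for `1 < p < ∞`). -/
def ApC {n : ℕ} (ρ : Rn n → ℝ) (σ p : ℝ) (w : Rn n → ℝ) : ℝ≥0∞ :=
  ⨆ (c : Rn n) (r : ℝ) (_ : 0 < r),
    (ENNReal.ofReal (psi ρ σ c r))⁻¹ *
      ((ENNReal.ofReal (r ^ n))⁻¹ * wMeas w (cube c r)) *
      ((ENNReal.ofReal (r ^ n))⁻¹ *
        ∫⁻ y in cube c r, ENNReal.ofReal (w y ^ (1 - p / (p - 1)))) ^ (p - 1)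
/-- The heat semigroup `e^{tΔ}` on `ℝ^n`. -/
def heatSg (n : ℕ) (t : ℝ) (g : Rn n → ℝ) (x : Rn n) : ℝ :=
  ∫ y : Rn n, (4 * Real.pi * t) ^ (-(n : ℝ) / 2) * Real.exp (-‖x - y‖ ^ 2 / (4 * t)) * g y

/-- The `ϱ`-variation operator of the classical heat semigroup. -/
def varHeat (n : ℕ) (ϱ : ℝ) (g : Rn n → ℝ) (x : Rn n) : ℝ≥0∞ :=
  ⨆ (t : ℕ → ℝ) (_ : StrictAnti t) (_ : ∀ j, 0 < t j)
      (_ : Filter.Tendsto t Filter.atTop (nhds 0)),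
    (∑' j : ℕ, ENNReal.ofReal (|heatSg n (t j) g x - heatSg n (t (j + 1)) g x| ^ ϱ)) ^ (1 / ϱ)

/-- Muckenhoupt `A₁`. -/
def IsA1 {n : ℕ} (w : Rn n → ℝ) : Prop :=
  ∃ C > (0 : ℝ), ∀ (c : Rn n) (r : ℝ), 0 < r →
    wMeas w (cube c r) ≤ ENNReal.ofReal C * ENNReal.ofReal (r ^ n) *
      essInf (fun x => ENNReal.ofReal (w x)) (volume.restrict (cube c r))

/-- Muckenhoupt `A_p`, `1 < p < ∞`. -/
def IsAp {n : ℕ} (p : ℝ) (w : Rn n → ℝ) : Prop :=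
  ∃ C > (0 : ℝ), ∀ (c : Rn n) (r : ℝ), 0 < r →
    wMeas w (cube c r) *
      (∫⁻ y in cube c r, ENNReal.ofReal (w y ^ (1 - p / (p - 1)))) ^ (p - 1) ≤
      ENNReal.ofReal C * (ENNReal.ofReal (r ^ n)) ^ p

/-- Muckenhoupt `A_∞ = ∪_{p ≥ 1} A_p`. -/
def IsAinfty {n : ℕ} (w : Rn n → ℝ) : Prop := IsA1 w ∨ ∃ p > (1 : ℝ), IsAp p w

/-- The class `A₁^{ρ,loc}`, with the `A₁` condition over balls `B(x,r)`, `r ≤ ρ(x)`. -/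
def IsA1loc {n : ℕ} (ρ : Rn n → ℝ) (w : Rn n → ℝ) : Prop :=
  ∃ C > (0 : ℝ), ∀ (x : Rn n) (r : ℝ), 0 < r → r ≤ ρ x →
    wMeas w (Metric.ball x r) ≤ ENNReal.ofReal C * volume (Metric.ball x r) *
      essInf (fun y => ENNReal.ofReal (w y)) (volume.restrict (Metric.ball x r))

/-- The class `A_p^{ρ,loc}` for `1 < p < ∞`. -/
def IsAploc {n : ℕ} (ρ : Rn n → ℝ) (p : ℝ) (w : Rn n → ℝ) : Prop :=
  ∃ C > (0 : ℝ), ∀ (x : Rn n) (r : ℝ), 0 < r → r ≤ ρ x →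
    wMeas w (Metric.ball x r) *
      (∫⁻ y in Metric.ball x r, ENNReal.ofReal (w y ^ (1 - p / (p - 1)))) ^ (p - 1) ≤
      ENNReal.ofReal C * (volume (Metric.ball x r)) ^ p

/-- `A_∞^{ρ,loc} = ∪_{p ≥ 1} A_p^{ρ,loc}`. -/
def IsAinfLoc {n : ℕ} (ρ : Rn n → ℝ) (w : Rn n → ℝ) : Prop :=
  IsA1loc ρ w ∨ ∃ p > (1 : ℝ), IsAploc ρ p w

/-- The class `A₁^{ρ,θ}`. -/
def IsA1rho {n : ℕ} (ρ : Rn n → ℝ) (θ : ℝ) (w : Rn n → ℝ) : Prop :=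
  ∃ C > (0 : ℝ), ∀ (c : Rn n) (r : ℝ), 0 < r →
    wMeas w (cube c r) ≤ ENNReal.ofReal (C * (psi ρ θ c r * r ^ n)) *
      essInf (fun x => ENNReal.ofReal (w x)) (volume.restrict (cube c r))

/-- The class `A_∞^ρ(μ)`. -/
def IsAinfRhoMu {n : ℕ} (ρ : Rn n → ℝ) (μ w : Rn n → ℝ) : Prop :=
  ∃ θ ≥ (0 : ℝ), ∃ ε > (0 : ℝ), ∃ C > (0 : ℝ), ∀ (c : Rn n) (r : ℝ), 0 < r →
    ∀ E ⊆ cube c r, MeasurableSet E →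
      wMeas (fun x => w x * μ x) E ≤ ENNReal.ofReal (C * psi ρ θ c r) *
        (wMeas μ E / wMeas μ (cube c r)) ^ ε * wMeas (fun x => w x * μ x) (cube c r)

/-- The class `A_∞^ρ`. -/
def IsAinfRho {n : ℕ} (ρ : Rn n → ℝ) (w : Rn n → ℝ) : Prop :=
  ∃ θ ≥ (0 : ℝ), ∃ δ > (0 : ℝ), ∃ C > (0 : ℝ), ∀ (c : Rn n) (r : ℝ), 0 < r →
    ∀ E ⊆ cube c r, MeasurableSet E →
      wMeas w E ≤ ENNReal.ofReal (C * psi ρ θ c r) *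
        (volume E / ENNReal.ofReal (r ^ n)) ^ δ * wMeas w (cube c r)

/-- Membership in `RH_∞^{ρ,θ}` with constant `C`. -/
def IsRHinf {n : ℕ} (ρ : Rn n → ℝ) (θ : ℝ) (w : Rn n → ℝ) (C : ℝ) : Prop :=
  ∀ (c : Rn n) (r : ℝ), 0 < r →
    essSup (fun x => ENNReal.ofReal (w x)) (volume.restrict (cube c r)) ≤
      ENNReal.ofReal (C * psi ρ θ c r) * ((ENNReal.ofReal (r ^ n))⁻¹ * wMeas w (cube c r))

/-- An `η`-sparse family of cubes, encoded by their (center, side length) data. -/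
def IsSparse {n : ℕ} (η : ℝ) (S : Set (Rn n × ℝ)) : Prop :=
  S.Countable ∧ (∀ Q ∈ S, 0 < Q.2) ∧
  ∃ E : Rn n × ℝ → Set (Rn n),
    (∀ Q ∈ S, MeasurableSet (E Q) ∧ E Q ⊆ cube Q.1 Q.2 ∧
      ENNReal.ofReal η * volume (cube Q.1 Q.2) ≤ volume (E Q)) ∧
    S.PairwiseDisjoint E

/-- The sparse operator `A_S^{ρ,N}`. -/
def sparseOp {n : ℕ} (ρ : Rn n → ℝ) (N : ℝ) (S : Set (Rn n × ℝ)) (f : Rn n → ℝ)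
    (x : Rn n) : ℝ≥0∞ :=
  ∑' Q : S, (cube (Q : Rn n × ℝ).1 (Q : Rn n × ℝ).2).indicator
    (fun _ => (ENNReal.ofReal ((3 * (Q : Rn n × ℝ).2) ^ n))⁻¹ *
      (∫⁻ y in cube (Q : Rn n × ℝ).1 (3 * (Q : Rn n × ℝ).2), ENNReal.ofReal |f y|) *
      (ENNReal.ofReal (psi ρ N (Q : Rn n × ℝ).1 (Q : Rn n × ℝ).2))⁻¹) x
open Filter Topology Metric

/-- The volume of the Euclidean unit ball. -/
def unitBallVol (n : ℕ) : ℝ := (volume (ball (0 : Rn n) 1)).toReal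

lemma unitBallVol_pos (n : ℕ) : 0 < unitBallVol n :=
  ENNReal.toReal_pos (measure_ball_pos volume _ one_pos).ne' measure_ball_lt_top.ne

lemma volume_closedBall_eq {n : ℕ} (x : Rn n) {r : ℝ} (hr : 0 ≤ r) :
    volume (closedBall x r) = ENNReal.ofReal (r ^ n * unitBallVol n) := by
  rw [Measure.addHaar_closedBall volume x hr, finrank_euclideanSpace_fin,
    ENNReal.ofReal_mul (by positivity), unitBallVol, ENNReal.ofReal_toReal measure_ball_lt_top.ne]

lemma wMeas_mono {n : ℕ} (w : Rn n → ℝ) {S T : Set (Rn n)} (h : S ⊆ T) :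
    wMeas w S ≤ wMeas w T :=
  lintegral_mono_set h

lemma IsWeight.isLocallyFiniteMeasure_withDensity {n : ℕ} {w : Rn n → ℝ} (hw : IsWeight w) :
    IsLocallyFiniteMeasure ((volume : Measure (Rn n)).withDensity fun x => ENNReal.ofReal (w x)) := by
  refine ⟨fun x => ?_⟩
  obtain ⟨U, hU, hint⟩ := hw.1 x
  obtain ⟨V, hVU, hV, hxV⟩ := _root_.mem_nhds_iff.1 hU
  refine ⟨V, hV.mem_nhds hxV, ?_⟩
  rw [withDensity_apply _ hV.measurableSet]
  exact (hint.mono_set hVU).lintegral_lt_top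

/-- Lebesgue differentiation for weights. -/
lemma IsWeight.ae_tendsto_wMeas_div {n : ℕ} {w : Rn n → ℝ} (hw : IsWeight w) :
    ∀ᵐ x : Rn n, Tendsto (fun r => wMeas w (closedBall x r) / volume (closedBall x r))
      (𝓝[>] 0) (𝓝 (ENNReal.ofReal (w x))) := by
  have := hw.isLocallyFiniteMeasure_withDensity
  have hm : AEMeasurable (fun x => ENNReal.ofReal (w x)) (volume : Measure (Rn n)) :=
    hw.1.aestronglyMeasurable.aemeasurable.ennreal_ofReal
  filter_upwards [Besicovitch.ae_tendsto_rnDeriv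
    ((volume : Measure (Rn n)).withDensity fun x => ENNReal.ofReal (w x)) volume,
    Measure.rnDeriv_withDensity₀ volume hm] with x hx hx'
  rw [hx'] at hx
  simpa only [wMeas, withDensity_apply _ measurableSet_closedBall] using hx

/-- Around almost every point, the weighted measure of small balls is comparable to volume. -/
lemma IsWeight.ae_eventually_wMeas_bounds {n : ℕ} {w : Rn n → ℝ} (hw : IsWeight w) :
    ∀ᵐ x : Rn n, ∃ a > 0, ∃ b > 0, ∀ᶠ r in 𝓝[>] (0 : ℝ),
      ENNReal.ofReal (a * r ^ n) ≤ wMeas w (closedBall x r) ∧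
        wMeas w (closedBall x r) ≤ ENNReal.ofReal (b * r ^ n) := by
  filter_upwards [hw.ae_tendsto_wMeas_div, hw.2] with x hx hpos
  have hv := unitBallVol_pos n
  refine ⟨w x / 2 * unitBallVol n, by positivity, 2 * w x * unitBallVol n, by positivity, ?_⟩
  have h1 : ENNReal.ofReal (w x / 2) < ENNReal.ofReal (w x) :=
    (ENNReal.ofReal_lt_ofReal_iff hpos).2 (by linarith)
  have h2 : ENNReal.ofReal (w x) < ENNReal.ofReal (2 * w x) :=
    (ENNReal.ofReal_lt_ofReal_iff (by positivity)).2 (by linarith)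
  filter_upwards [hx.eventually_const_lt h1, hx.eventually_lt_const h2, self_mem_nhdsWithin]
    with r hr1 hr2 (hr : 0 < r)
  rw [volume_closedBall_eq x hr.le] at hr1 hr2
  have h0 : ENNReal.ofReal (r ^ n * unitBallVol n) ≠ 0 := by
    rw [ne_eq, ENNReal.ofReal_eq_zero, not_le]; positivity
  constructor
  · have := (ENNReal.le_div_iff_mul_le (.inl h0) (.inl ENNReal.ofReal_ne_top)).1 hr1.le
    rw [← ENNReal.ofReal_mul (by positivity)] at this
    convert this using 2; ring
  · have := (ENNReal.div_le_iff h0 ENNReal.ofReal_ne_top).1 hr2.le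
    rw [← ENNReal.ofReal_mul (by positivity)] at this
    convert this using 2; ring

lemma lorentzP1_indicator_le {n : ℕ} {p : ℝ} (hp : 0 < p) (w : Rn n → ℝ) (S : Set (Rn n)) :
    lorentzP1 p w (S.indicator fun _ => 1) ≤ ENNReal.ofReal p * wMeas w S ^ (1 / p) := by
  unfold lorentzP1
  gcongr
  calc ∫⁻ y in Ioi (0 : ℝ), wMeas w {x | y < |S.indicator (fun _ => (1 : ℝ)) x|} ^ (1 / p)
      ≤ ∫⁻ y in Ioi (0 : ℝ), (Iio (1 : ℝ)).indicator (fun _ => wMeas w S ^ (1 / p)) y := by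
        refine setLIntegral_mono' measurableSet_Ioi fun y (hy : 0 < y) => ?_
        by_cases h1 : y < 1
        · rw [indicator_of_mem (show y ∈ Iio (1 : ℝ) from h1)]
          gcongr
          refine wMeas_mono w fun x hx => ?_
          by_contra hxS
          simp [hxS] at hx
          linarith
        · have hempty : {x | y < |S.indicator (fun _ => (1 : ℝ)) x|} = ∅ := by
            ext x
            by_cases hxS : x ∈ S <;> simp [hxS] <;> linarith
          simp [hempty, wMeas, hp]
    _ = wMeas w S ^ (1 / p) := by
        rw [lintegral_indicator measurableSet_Iio, setLIntegral_const,
          Measure.restrict_apply measurableSet_Iio, Iio_inter_Ioi]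
        simp

lemma closedBall_subset_cube {n : ℕ} (x : Rn n) (r : ℝ) : closedBall x r ⊆ cube x (2 * r) := by
  intro y hy i
  have h := PiLp.norm_apply_le (y - x) i
  rw [mem_closedBall, dist_eq_norm] at hy
  rw [PiLp.sub_apply, Real.norm_eq_abs] at h
  linarith

/-- On a small ball, the fractional maximal function of its indicator is at least `K r ^ α`. -/
lemma exists_le_fracMax_indicator {n : ℕ} {ρ : Rn n → ℝ} {θ α : ℝ} (x : Rn n) (hρ : 0 < ρ x)
    (hθ : 0 ≤ θ) (hn : (0 : ℝ) < n) (hαn : α < n) :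
    ∃ K > 0, ∀ r, 0 < r → r ≤ 1 → ∀ y ∈ closedBall x r,
      ENNReal.ofReal (K * r ^ α) ≤ fracMax n ρ θ α ((closedBall x r).indicator fun _ => 1) y := by
  have hv := unitBallVol_pos n
  set P : ℝ := (1 + 2 / ρ x) ^ θ
  have hP : 0 < P := by positivity
  refine ⟨(P * 2 ^ n) ^ (α / n - 1) * unitBallVol n, by positivity, fun r hr hr1 y hy => ?_⟩
  have hexp : α / n - 1 ≤ 0 := by
    rw [sub_nonpos, div_le_one hn]; exact hαn.le
  have hpsi : psi ρ θ x (2 * r) ≤ P := by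
    unfold psi
    refine Real.rpow_le_rpow (by positivity) ?_ hθ
    gcongr
    linarith
  have hpsi0 : 0 < psi ρ θ x (2 * r) := by unfold psi; positivity
  have hint : ∫⁻ z in cube x (2 * r),
      ENNReal.ofReal |(closedBall x r).indicator (fun _ => (1 : ℝ)) z| ≥
        ENNReal.ofReal (r ^ n * unitBallVol n) := by
    calc ENNReal.ofReal (r ^ n * unitBallVol n) = ∫⁻ _ in closedBall x r, 1 := by
          rw [setLIntegral_one, volume_closedBall_eq x hr.le]
      _ = ∫⁻ z in closedBall x r,
          ENNReal.ofReal |(closedBall x r).indicator (fun _ => (1 : ℝ)) z| := by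
          refine setLIntegral_congr_fun measurableSet_closedBall fun z hz => ?_
          simp [indicator_of_mem hz]
      _ ≤ _ := lintegral_mono_set (closedBall_subset_cube x r)
  have hpow : (P * 2 ^ n) ^ (α / n - 1) * unitBallVol n * r ^ α =
      (P * (2 * r) ^ n) ^ (α / n - 1) * (r ^ n * unitBallVol n) := by
    have : r ^ α = (r ^ n) ^ (α / n - 1) * r ^ n := by
      rw [← Real.rpow_natCast r n, ← Real.rpow_mul hr.le, ← Real.rpow_add hr]
      congr 1
      field_simp
      ring
    rw [mul_pow, ← mul_assoc P, Real.mul_rpow (x := P * 2 ^ n) (by positivity) (by positivity), this]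
    ring
  calc ENNReal.ofReal ((P * 2 ^ n) ^ (α / n - 1) * unitBallVol n * r ^ α)
      = ENNReal.ofReal ((P * (2 * r) ^ n) ^ (α / n - 1)) *
          ENNReal.ofReal (r ^ n * unitBallVol n) := by
        rw [hpow, ENNReal.ofReal_mul (by positivity)]
    _ ≤ ENNReal.ofReal ((psi ρ θ x (2 * r) * (2 * r) ^ n) ^ (α / n - 1)) *
          ∫⁻ z in cube x (2 * r),
            ENNReal.ofReal |(closedBall x r).indicator (fun _ => (1 : ℝ)) z| := by
        refine mul_le_mul' (ENNReal.ofReal_le_ofReal ?_) hint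
        refine Real.rpow_le_rpow_of_nonpos (by positivity) ?_ hexp
        gcongr
    _ ≤ _ := le_iSup_of_le x <| le_iSup_of_le (2 * r) <|
        le_iSup_of_le (mul_pos two_pos hr) (by rw [iSup_pos (closedBall_subset_cube x r hy)])

/-- If `r ^ s` is bounded by a multiple of `r ^ t` near `0`, then `t ≤ s`. -/
lemma le_of_eventually_rpow_le {A B s t : ℝ} (hA : 0 < A)
    (h : ∀ᶠ r in 𝓝[>] (0 : ℝ), A * r ^ s ≤ B * r ^ t) : t ≤ s := by
  by_contra! hlt
  have hlim := tendsto_rpow_neg_nhdsGT_zero (sub_neg.2 hlt)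
  obtain ⟨r, h1, h2, hr : 0 < r⟩ :=
    (h.and ((hlim.eventually_gt_atTop (B / A)).and self_mem_nhdsWithin)).exists
  rw [div_lt_iff₀ hA, Real.rpow_sub hr, div_mul_eq_mul_div,
    lt_div_iff₀ (Real.rpow_pos_of_pos hr t)] at h2
  linarith

/-- If `M_α^{ρ,θ}` maps `L^{p,1}(μ)` to `L^{q,∞}(ν)` boundedly with `0 < α < n`,
then `1/p - 1/q ≤ α/n`. -/
theorem statement6 (n : ℕ) (ρ : Rn n → ℝ) (hρ : IsCriticalRadius ρ)
    (θ α p q : ℝ) (hθ : 0 ≤ θ) (hα : 0 < α) (hαn : α < n) (hp : 1 ≤ p) (hpq : p ≤ q)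
    (μ ν : Rn n → ℝ) (hμ : IsWeight μ) (hν : IsWeight ν)
    (c : ℝ) (hc : 0 < c)
    (hbd : ∀ f : Rn n → ℝ, Measurable f →
      weakNormE q ν (fracMax n ρ θ α f) ≤ ENNReal.ofReal c * lorentzP1 p μ f) :
    1 / p - 1 / q ≤ α / n := by
  have hn : (0 : ℝ) < n := hα.trans hαn
  have hp0 : 0 < p := one_pos.trans_le hp
  have hq0 : 0 < q := hp0.trans_le hpq
  obtain ⟨_, _, _, _, hρpos, _⟩ := hρ
  obtain ⟨x, ⟨_, _, b, hb, hμx⟩, a, ha, _, _, hνx⟩ :=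
    (hμ.ae_eventually_wMeas_bounds.and hν.ae_eventually_wMeas_bounds).exists
  obtain ⟨K, hK, hmax⟩ := exists_le_fracMax_indicator (ρ := ρ) x (hρpos x) hθ hn hαn
  have key : ∀ᶠ r in 𝓝[>] (0 : ℝ), K / 2 * a ^ (1 / q) * r ^ (α + n * (1 / q)) ≤
      c * p * b ^ (1 / p) * r ^ (n * (1 / p)) := by
    filter_upwards [hμx, hνx, Ioc_mem_nhdsGT one_pos] with r hμr hνr ⟨hr, hr1⟩
    have hweak : ENNReal.ofReal (K / 2 * r ^ α) * wMeas ν (closedBall x r) ^ (1 / q) ≤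
        weakNormE q ν (fracMax n ρ θ α ((closedBall x r).indicator fun _ => 1)) := by
      refine le_iSup_of_le (K / 2 * r ^ α) (le_iSup_of_le (by positivity) ?_)
      gcongr
      refine wMeas_mono ν fun y hy => lt_of_lt_of_le ?_ (hmax r hr hr1 y hy)
      have : 0 < K * r ^ α := by positivity
      exact (ENNReal.ofReal_lt_ofReal_iff this).2 (by linarith)
    have hE : ENNReal.ofReal (K / 2 * r ^ α) * ENNReal.ofReal (a * r ^ n) ^ (1 / q) ≤
        ENNReal.ofReal c * (ENNReal.ofReal p * ENNReal.ofReal (b * r ^ n) ^ (1 / p)) :=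
      calc _ ≤ ENNReal.ofReal (K / 2 * r ^ α) * wMeas ν (closedBall x r) ^ (1 / q) := by
            gcongr; exact hνr.1
        _ ≤ _ := hweak
        _ ≤ _ := hbd _ (measurable_const.indicator measurableSet_closedBall)
        _ ≤ ENNReal.ofReal c * (ENNReal.ofReal p * wMeas μ (closedBall x r) ^ (1 / p)) := by
            gcongr; exact lorentzP1_indicator_le hp0 μ _
        _ ≤ _ := by gcongr; exact hμr.2
    rw [ENNReal.ofReal_rpow_of_pos (by positivity), ENNReal.ofReal_rpow_of_pos (by positivity),
      ← ENNReal.ofReal_mul (by positivity), ← ENNReal.ofReal_mul (by positivity),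
      ← ENNReal.ofReal_mul (by positivity), ENNReal.ofReal_le_ofReal_iff (by positivity),
      Real.mul_rpow ha.le (by positivity), Real.mul_rpow hb.le (by positivity),
      ← Real.rpow_natCast r n, ← Real.rpow_mul hr.le, ← Real.rpow_mul hr.le] at hE
    rw [Real.rpow_add hr]
    linarith
  have hexp := le_of_eventually_rpow_le (by positivity) key
  rw [le_div_iff₀ hn]
  linarith
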